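/- Let d₁, c, β > 0 and set λ₁ = (c - √(c² + 4βd₁))/(2d₁) and λ₂ = (c + √(c² + 4βd₁))/(2d₁), the two roots of d₁λ² - cλ - β = 0. Let f : [0,∞) → ℝ be continuous with |f(s)| ≤ A·e^{αs} for all s ≥ 0, where A > 0 and 0 < α < min(-λ₁, λ₂). Then the problem d₁y''(s) - cy'(s) - βy(s) + f(s) = 0 for s ∈ (0,∞), y(0) = 0, has a unique twice continuously differentiable solution y on [0,∞) satisfying |y(s)| ≤ M·e^{αs} for some constant M and all s ≥ 0, and this solution is given explicitly by y(s) = (1/(d₁(λ₂ - λ₁)))·[ ∫₀^s e^{λ₁ s}(e^{-λ₁ ξ} - e^{-λ₂ ξ}) f(ξ) dξ + ∫_s^∞ (e^{λ₂ s} - e^{λ₁ s}) e^{-λ₂ ξ} f(ξ) dξ ]. -/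

import Mathlib

open Real Filter Set MeasureTheory

noncomputable def lam1 (c β d1 : ℝ) : ℝ := (c - Real.sqrt (c ^ 2 + 4 * β * d1)) / (2 * d1)
noncomputable def lam2 (c β d1 : ℝ) : ℝ := (c + Real.sqrt (c ^ 2 + 4 * β * d1)) / (2 * d1)

/-- `y` solves `d₁ y'' - c y' - β y + f = 0` on `(0,∞)`, `y(0) = 0`,
with `y(s) = O(e^{α s})` as `s → ∞`. -/
def IsLinSolution (d1 c β α : ℝ) (f y : ℝ → ℝ) : Prop :=
  ContDiffOn ℝ 2 y (Set.Ici 0) ∧ y 0 = 0 ∧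
  (∀ s > (0:ℝ), d1 * deriv (deriv y) s - c * deriv y s - β * y s + f s = 0) ∧
  ∃ M : ℝ, ∀ s ≥ (0:ℝ), |y s| ≤ M * Real.exp (α * s)

/-- The explicit solution given by the variation of constants formula. -/
noncomputable def linSol (d1 c β : ℝ) (f : ℝ → ℝ) (s : ℝ) : ℝ :=
  (1 / (d1 * (lam2 c β d1 - lam1 c β d1))) *
    ((∫ ξ in Set.Ioc (0:ℝ) s,
        Real.exp (lam1 c β d1 * s) *
          (Real.exp (-(lam1 c β d1 * ξ)) - Real.exp (-(lam2 c β d1 * ξ))) * f ξ) +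
     ∫ ξ in Set.Ioi s,
        (Real.exp (lam2 c β d1 * s) - Real.exp (lam1 c β d1 * s)) *
          Real.exp (-(lam2 c β d1 * ξ)) * f ξ)

theorem lam_facts (c β d1 : ℝ) (hd1 : 0 < d1) (hβ : 0 < β) :
    lam1 c β d1 < lam2 c β d1 ∧ d1 * (lam1 c β d1 + lam2 c β d1) = c ∧
      d1 * (lam1 c β d1 * lam2 c β d1) = -β := by
  have hpos : 0 < c ^ 2 + 4 * β * d1 := by positivity
  have hs := Real.sqrt_pos.2 hpos
  have hq := Real.sq_sqrt hpos.le
  refine ⟨?_, ?_, ?_⟩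
  · unfold lam1 lam2
    apply div_lt_div_of_pos_right _ (by positivity)
    linarith
  · unfold lam1 lam2
    field_simp
    ring
  · unfold lam1 lam2
    generalize Real.sqrt (c ^ 2 + 4 * β * d1) = r at *
    field_simp
    linear_combination -hq

theorem exp_const (l : ℝ) (u : ℝ → ℝ) (hu : ∀ s > (0:ℝ), HasDerivAt u (l * u s) s) :
    ∃ C : ℝ, ∀ s > (0:ℝ), u s = C * Real.exp (l * s) := by
  have key : ∀ s > (0:ℝ), HasDerivAt (fun s => u s * Real.exp (-(l * s))) 0 s := by
    intro s hs
    have h1 : HasDerivAt (fun s : ℝ => Real.exp (-(l * s))) (Real.exp (-(l * s)) * (-(l * 1))) s :=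
      (((hasDerivAt_id s).const_mul l).neg).exp
    have := (hu s hs).mul h1
    refine HasDerivAt.congr_deriv this ?_
    ring
  refine ⟨u 1 * Real.exp (-(l * 1)), fun s hs => ?_⟩
  have := isOpen_Ioi.is_const_of_deriv_eq_zero (s := Set.Ioi (0:ℝ)) (convex_Ioi 0).isPreconnected
    (f := fun s => u s * Real.exp (-(l * s)))
    (fun x hx => (key x hx).differentiableAt.differentiableWithinAt)
    (fun x hx => (key x hx).deriv) (x := s) (y := 1) hs (by simp)
  replace this : u s * Real.exp (-(l * s)) = u 1 * Real.exp (-(l * 1)) := this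
  rw [← this, mul_assoc, ← Real.exp_add]
  simp

theorem sol_unique (d1 c β α l1 l2 : ℝ) (hd1 : 0 < d1) (hl : l1 < l2) (hl1 : l1 < 0)
    (hα : 0 < α) (hl2 : α < l2)
    (hsum : d1 * (l1 + l2) = c) (hprod : d1 * (l1 * l2) = -β) (f y z : ℝ → ℝ)
    (hy : IsLinSolution d1 c β α f y) (hz : IsLinSolution d1 c β α f z) :
    Set.EqOn y z (Set.Ici 0) := by
  obtain ⟨hy1, hy2, hy3, My, hy4⟩ := hy
  obtain ⟨hz1, hz2, hz3, Mz, hz4⟩ := hz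
  have hd : ∀ y : ℝ → ℝ, ContDiffOn ℝ 2 y (Set.Ici 0) → ∀ s > (0:ℝ),
      HasDerivAt y (deriv y s) s ∧ HasDerivAt (deriv y) (deriv (deriv y) s) s := by
    intro y hy s hs
    have h0 : ContDiffOn ℝ (1 + 1) y (Set.Ioi 0) := by
      have := hy.mono Set.Ioi_subset_Ici_self
      rwa [show (1 + 1 : WithTop ℕ∞) = 2 by norm_num]
    have h1 := (contDiffOn_succ_iff_deriv_of_isOpen isOpen_Ioi).1 h0
    have hm : Set.Ioi (0:ℝ) ∈ nhds s := Ioi_mem_nhds hs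
    exact ⟨(h1.1.differentiableAt hm).hasDerivAt,
      ((h1.2.2.differentiableOn (by norm_num)).differentiableAt hm).hasDerivAt⟩
  set w : ℝ → ℝ := fun s => y s - z s with hw
  set w' : ℝ → ℝ := fun s => deriv y s - deriv z s with hw'
  set w'' : ℝ → ℝ := fun s => deriv (deriv y) s - deriv (deriv z) s with hw''
  have hdw : ∀ s > (0:ℝ), HasDerivAt w (w' s) s := fun s hs =>
    (hd y hy1 s hs).1.sub (hd z hz1 s hs).1
  have hdw' : ∀ s > (0:ℝ), HasDerivAt w' (w'' s) s := fun s hs =>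
    (hd y hy1 s hs).2.sub (hd z hz1 s hs).2
  have hode : ∀ s > (0:ℝ), w'' s = (l1 + l2) * w' s - l1 * l2 * w s := by
    intro s hs
    have e1 := hy3 s hs
    have e2 := hz3 s hs
    apply mul_left_cancel₀ hd1.ne'
    simp only [hw, hw', hw'']
    linear_combination e1 - e2 - (deriv y s - deriv z s) * hsum + (y s - z s) * hprod
  obtain ⟨C, hC⟩ := exp_const l2 (fun s => w' s - l1 * w s) (fun s hs => by
    have := (hdw' s hs).sub ((hdw s hs).const_mul l1)
    refine HasDerivAt.congr_deriv this ?_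
    rw [hode s hs]; ring)
  obtain ⟨D, hD⟩ := exp_const l1 (fun s => w' s - l2 * w s) (fun s hs => by
    have := (hdw' s hs).sub ((hdw s hs).const_mul l2)
    refine HasDerivAt.congr_deriv this ?_
    rw [hode s hs]; ring)
  have hne : l2 - l1 ≠ 0 := by linarith
  have hform : ∀ s > (0:ℝ), (l2 - l1) * w s = C * Real.exp (l2 * s) - D * Real.exp (l1 * s) := by
    intro s hs
    have e1 := hC s hs
    have e2 := hD s hs
    linear_combination e1 - e2
  have hw0 : w 0 = 0 := by simp [hw, hy2, hz2]
  have hcont : ContinuousOn w (Set.Ici 0) := hy1.continuousOn.sub hz1.continuousOn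
  have hCD : C - D = 0 := by
    have t1 : Tendsto (fun s => (l2 - l1) * w s) (nhdsWithin 0 (Set.Ioi 0)) (nhds ((l2 - l1) * w 0)) :=
      (((hcont 0 (by simp)).mono Set.Ioi_subset_Ici_self).const_mul (l2 - l1) :)
    have t2 : Tendsto (fun s => C * Real.exp (l2 * s) - D * Real.exp (l1 * s))
        (nhdsWithin 0 (Set.Ioi 0)) (nhds (C * Real.exp (l2 * 0) - D * Real.exp (l1 * 0))) := by
      apply Tendsto.mono_left _ nhdsWithin_le_nhds
      exact (by fun_prop : Continuous fun s : ℝ =>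
        C * Real.exp (l2 * s) - D * Real.exp (l1 * s)).tendsto 0
    have t3 := t2.congr' (f₂ := fun s => (l2 - l1) * w s) (by
      filter_upwards [self_mem_nhdsWithin] with s hs
      exact (hform s hs).symm)
    have := tendsto_nhds_unique t1 t3
    simp [hw0] at this
    linarith
  have hC0 : C = 0 := by
    have hb : ∀ s > (0:ℝ), |C| ≤ ((l2 - l1) * (My + Mz)) * Real.exp ((α - l2) * s)
        + |D| * Real.exp ((l1 - l2) * s) := by
      intro s hs
      have e := hform s hs
      have hE := Real.exp_pos (l2 * s)
      have b1 := hy4 s hs.le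
      have b2 := hz4 s hs.le
      have b3 : |w s| ≤ (My + Mz) * Real.exp (α * s) := by
        have := abs_sub (y s) (z s)
        simp only [hw]
        linarith
      have e2 : C * Real.exp (l2 * s) = (l2 - l1) * w s + D * Real.exp (l1 * s) := by linarith
      have b4 : |C| * Real.exp (l2 * s) ≤
          (l2 - l1) * ((My + Mz) * Real.exp (α * s)) + |D| * Real.exp (l1 * s) := by
        rw [← abs_of_pos hE, ← abs_mul, e2]
        refine (abs_add_le _ _).trans ?_
        rw [abs_mul, abs_mul, abs_of_pos (Real.exp_pos (l1 * s)), abs_of_pos (sub_pos.2 hl)]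
        have := mul_le_mul_of_nonneg_left b3 (sub_pos.2 hl).le
        linarith
      have x1 : Real.exp (α * s) = Real.exp ((α - l2) * s) * Real.exp (l2 * s) := by
        rw [← Real.exp_add]; ring_nf
      have x2 : Real.exp (l1 * s) = Real.exp ((l1 - l2) * s) * Real.exp (l2 * s) := by
        rw [← Real.exp_add]; ring_nf
      rw [x1, x2] at b4
      refine le_of_mul_le_mul_right ?_ hE
      linarith
    have ht : ∀ k < (0:ℝ), Tendsto (fun s : ℝ => Real.exp (k * s)) atTop (nhds 0) := fun k hk =>
      Real.tendsto_exp_atBot.comp (tendsto_id.const_mul_atTop_of_neg hk)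
    have t := ((ht (α - l2) (by linarith)).const_mul ((l2 - l1) * (My + Mz))).add
      ((ht (l1 - l2) (by linarith)).const_mul |D|)
    have := ge_of_tendsto t (by filter_upwards [eventually_gt_atTop 0] with s hs using hb s hs)
    simp at this
    exact this
  have hD0 : D = 0 := by linarith
  intro s hs
  rcases eq_or_lt_of_le (show (0:ℝ) ≤ s from hs) with h | h
  · rw [← h, hy2, hz2]
  · have := hform s h
    rw [hC0, hD0] at this
    have h2 : w s = 0 := by
      rcases mul_eq_zero.1 (this.trans (by ring)) with h | h
      · exact absurd h hne
      · exact h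
    simp only [hw] at h2
    linarith

theorem tail_bound (A α l2 : ℝ) (hl2 : α < l2) (f : ℝ → ℝ) (hf : ContinuousOn f (Set.Ici 0))
    (hfb : ∀ s ≥ (0:ℝ), |f s| ≤ A * Real.exp (α * s)) (s : ℝ) (hs : 0 ≤ s) :
    IntegrableOn (fun ξ => Real.exp (-(l2 * ξ)) * f ξ) (Set.Ioi s) ∧
    |∫ ξ in Set.Ioi s, Real.exp (-(l2 * ξ)) * f ξ| ≤
      A / (l2 - α) * Real.exp ((α - l2) * s) := by
  have hi : IntegrableOn (fun ξ => A * Real.exp ((α - l2) * ξ)) (Set.Ioi s) :=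
    (integrableOn_exp_mul_Ioi (by linarith) s).const_mul A
  have hb : ∀ ξ ∈ Set.Ioi s, ‖Real.exp (-(l2 * ξ)) * f ξ‖ ≤ A * Real.exp ((α - l2) * ξ) := by
    intro ξ hξ
    rw [norm_mul, Real.norm_eq_abs, Real.norm_eq_abs, abs_of_pos (Real.exp_pos _)]
    have := mul_le_mul_of_nonneg_left (hfb ξ (hs.trans (le_of_lt hξ))) (Real.exp_pos (-(l2 * ξ))).le
    refine this.trans (le_of_eq ?_)
    rw [show (α - l2) * ξ = -(l2 * ξ) + α * ξ by ring, Real.exp_add]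
    ring
  have hsub : Set.Ioi s ⊆ Set.Ici 0 := fun x hx => hs.trans (le_of_lt hx)
  have hm : AEStronglyMeasurable (fun ξ => Real.exp (-(l2 * ξ)) * f ξ)
      (volume.restrict (Set.Ioi s)) := by
    apply ContinuousOn.aestronglyMeasurable _ measurableSet_Ioi
    exact (by fun_prop : Continuous fun ξ : ℝ => Real.exp (-(l2 * ξ))).continuousOn.mul (hf.mono hsub)
  have hae := (ae_restrict_iff' (μ := volume) measurableSet_Ioi).2 (Eventually.of_forall hb)
  refine ⟨hi.mono' hm hae, ?_⟩
  have := norm_integral_le_of_norm_le hi hae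
  rw [Real.norm_eq_abs] at this
  refine this.trans (le_of_eq ?_)
  rw [integral_const_mul, integral_exp_mul_Ioi (by linarith)]
  have : α - l2 ≠ 0 := by linarith
  have : l2 - α ≠ 0 := by linarith
  rw [show α - l2 = -(l2 - α) by ring]
  field_simp

theorem head_bound (A α l1 : ℝ) (hl1 : l1 < α) (hA : 0 < A) (g : ℝ → ℝ)
    (hfb : ∀ s ≥ (0:ℝ), |g s| ≤ A * Real.exp (α * s)) (s : ℝ) (hs : 0 ≤ s) :
    |∫ ξ in (0:ℝ)..s, Real.exp (-(l1 * ξ)) * g ξ| ≤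
      A / (α - l1) * Real.exp ((α - l1) * s) := by
  have hb : ∀ ξ ∈ Set.Ioc 0 s, ‖Real.exp (-(l1 * ξ)) * g ξ‖ ≤ A * Real.exp ((α - l1) * ξ) := by
    intro ξ hξ
    rw [norm_mul, Real.norm_eq_abs, Real.norm_eq_abs, abs_of_pos (Real.exp_pos _)]
    have := mul_le_mul_of_nonneg_left (hfb ξ hξ.1.le) (Real.exp_pos (-(l1 * ξ))).le
    refine this.trans (le_of_eq ?_)
    rw [show (α - l1) * ξ = -(l1 * ξ) + α * ξ by ring, Real.exp_add]
    ring
  have := intervalIntegral.norm_integral_le_of_norm_le (μ := volume) hs (Eventually.of_forall hb)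
    ((by fun_prop : Continuous fun ξ : ℝ => A * Real.exp ((α - l1) * ξ)).intervalIntegrable 0 s)
  rw [Real.norm_eq_abs] at this
  refine this.trans ?_
  have hp : 0 < α - l1 := by linarith
  rw [intervalIntegral.integral_const_mul,
    intervalIntegral.integral_comp_mul_left (fun x => Real.exp x) hp.ne', integral_exp]
  simp only [mul_zero, Real.exp_zero, smul_eq_mul]
  rw [div_mul_eq_mul_div, mul_div_assoc, div_eq_inv_mul]
  gcongr
  linarith

theorem sol_exists (d1 c β A α : ℝ) (hd1 : 0 < d1)
    (hβ : 0 < β) (hA : 0 < A) (hα : 0 < α) (hl1 : lam1 c β d1 < 0) (hl2 : α < lam2 c β d1)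
    (f : ℝ → ℝ) (hf : ContinuousOn f (Set.Ici 0))
    (hfb : ∀ s ≥ (0:ℝ), |f s| ≤ A * Real.exp (α * s)) :
    IsLinSolution d1 c β α f (linSol d1 c β f) := by
  obtain ⟨hl, hsum, hprod⟩ := lam_facts c β d1 hd1 hβ
  unfold IsLinSolution
  have hlin : ∀ s, linSol d1 c β f s = linSol d1 c β f s := fun _ => rfl
  conv at hlin => 
    intro s
    rhs
    unfold linSol
  generalize linSol d1 c β f = L at *
  generalize lam1 c β d1 = l1 at *
  generalize lam2 c β d1 = l2 at *
  set g : ℝ → ℝ := fun x => f (max x 0) with hg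
  have hgc : Continuous g := by
    apply hf.comp_continuous (f := fun x : ℝ => max x 0) (by fun_prop)
    intro x; exact le_max_right x 0
  have hgf : ∀ x ≥ (0:ℝ), g x = f x := fun x hx => by simp [hg, max_eq_left hx]
  have hgb : ∀ s ≥ (0:ℝ), |g s| ≤ A * Real.exp (α * s) := fun s hs => by
    rw [hgf s hs]; exact hfb s hs
  set K : ℝ := 1 / (d1 * (l2 - l1)) with hK
  have hKd : K * (d1 * (l2 - l1)) = 1 := by
    rw [hK]; have : l2 - l1 ≠ 0 := by linarith
    field_simp
  set P : ℝ → ℝ := fun s => ∫ ξ in (0:ℝ)..s, Real.exp (-(l1 * ξ)) * g ξ with hP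
  set Q : ℝ → ℝ := fun s => ∫ ξ in (0:ℝ)..s, Real.exp (-(l2 * ξ)) * g ξ with hQ
  set J : ℝ := ∫ ξ in Set.Ioi (0:ℝ), Real.exp (-(l2 * ξ)) * f ξ with hJ
  have hc1 : ∀ l : ℝ, Continuous fun ξ => Real.exp (-(l * ξ)) * g ξ := fun l => by fun_prop
  have hdP : ∀ s, HasDerivAt P (Real.exp (-(l1 * s)) * g s) s := fun s =>
    (hc1 l1).integral_hasStrictDerivAt 0 s |>.hasDerivAt
  have hdQ : ∀ s, HasDerivAt Q (Real.exp (-(l2 * s)) * g s) s := fun s =>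
    (hc1 l2).integral_hasStrictDerivAt 0 s |>.hasDerivAt
  have hdE : ∀ l s : ℝ, HasDerivAt (fun s : ℝ => Real.exp (l * s)) (l * Real.exp (l * s)) s := by
    intro l s
    have := ((hasDerivAt_id s).const_mul l).exp
    refine HasDerivAt.congr_deriv this ?_
    simp only [id]; ring
  have hIoc : ∀ (l s : ℝ), 0 ≤ s → ∫ ξ in Set.Ioc (0:ℝ) s, Real.exp (-(l * ξ)) * f ξ
      = ∫ ξ in (0:ℝ)..s, Real.exp (-(l * ξ)) * g ξ := by
    intro l s hs
    rw [intervalIntegral.integral_of_le hs]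
    apply setIntegral_congr_fun measurableSet_Ioc
    intro x hx
    simp only [hgf x hx.1.le]
  have hIint : ∀ (l s : ℝ), IntegrableOn (fun ξ => Real.exp (-(l * ξ)) * f ξ) (Set.Ioc 0 s) := by
    intro l s
    refine IntegrableOn.congr_fun (f := fun ξ => Real.exp (-(l * ξ)) * g ξ) ?_ ?_ measurableSet_Ioc
    · exact ((hc1 l).integrableOn_Icc).mono_set Set.Ioc_subset_Icc_self
    · intro x hx
      simp only [hgf x hx.1.le]
  have htail : ∀ s : ℝ, 0 ≤ s → ∫ ξ in Set.Ioi s, Real.exp (-(l2 * ξ)) * f ξ = J - Q s := by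
    intro s hs
    have h1 := setIntegral_union (μ := volume) (f := fun ξ => Real.exp (-(l2 * ξ)) * f ξ)
      (Set.Ioc_disjoint_Ioi (a := (0:ℝ)) (le_refl s)) measurableSet_Ioi (hIint l2 s)
      (tail_bound A α l2 hl2 f hf hfb s hs).1
    rw [Set.Ioc_union_Ioi_eq_Ioi hs, hIoc l2 s hs] at h1
    simp only [hJ, hQ]
    linarith
  set Y : ℝ → ℝ := fun s =>
    K * (Real.exp (l1 * s) * (P s - J) + Real.exp (l2 * s) * (J - Q s)) with hY
  set Y' : ℝ → ℝ := fun s =>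
    K * (l1 * Real.exp (l1 * s) * (P s - J) + l2 * Real.exp (l2 * s) * (J - Q s)) with hY'
  set Y'' : ℝ → ℝ := fun s =>
    K * (l1 ^ 2 * Real.exp (l1 * s) * (P s - J) + l2 ^ 2 * Real.exp (l2 * s) * (J - Q s)
      + (l1 - l2) * g s) with hY''
  have hLY : ∀ s : ℝ, 0 ≤ s → L s = Y s := by
    intro s hs
    rw [hlin s]
    have i1 : ∫ ξ in Set.Ioc (0:ℝ) s,
        Real.exp (l1 * s) * (Real.exp (-(l1 * ξ)) - Real.exp (-(l2 * ξ))) * f ξ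
        = Real.exp (l1 * s) * (P s - Q s) := by
      simp only [hP, hQ]
      rw [← hIoc l1 s hs, ← hIoc l2 s hs, ← integral_sub (hIint l1 s) (hIint l2 s),
        ← integral_const_mul]
      congr 1; ext ξ; ring
    have i2 : ∫ ξ in Set.Ioi s,
        (Real.exp (l2 * s) - Real.exp (l1 * s)) * Real.exp (-(l2 * ξ)) * f ξ
        = (Real.exp (l2 * s) - Real.exp (l1 * s)) * (J - Q s) := by
      rw [← htail s hs, ← integral_const_mul]
      congr 1; ext ξ; ring
    rw [i1, i2]
    simp only [hY]
    ring
  have hinv : ∀ l s : ℝ, Real.exp (l * s) * Real.exp (-(l * s)) = 1 := fun l s => by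
    rw [← Real.exp_add]; simp
  have hdY : ∀ s, HasDerivAt Y (Y' s) s := by
    intro s
    have := ((((hdE l1 s).mul ((hdP s).sub_const J))).add
      ((hdE l2 s).mul ((hdQ s).const_sub J))).const_mul K
    refine HasDerivAt.congr_deriv this ?_
    simp only [hY', id]
    linear_combination (K * g s) * hinv l1 s - (K * g s) * hinv l2 s
  have hdY' : ∀ s, HasDerivAt Y' (Y'' s) s := by
    intro s
    have := (((((hdE l1 s).const_mul l1).mul ((hdP s).sub_const J))).add
      (((hdE l2 s).const_mul l2).mul ((hdQ s).const_sub J))).const_mul K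
    refine HasDerivAt.congr_deriv this ?_
    simp only [hY'']
    linear_combination (K * l1 * g s) * hinv l1 s - (K * l2 * g s) * hinv l2 s
  have hPc : Continuous P := continuous_iff_continuousAt.2 fun s => (hdP s).continuousAt
  have hQc : Continuous Q := continuous_iff_continuousAt.2 fun s => (hdQ s).continuousAt
  have hYc : Continuous Y'' := by simp only [hY'']; fun_prop
  have eY : deriv Y = Y' := funext fun s => (hdY s).deriv
  have eY' : deriv Y' = Y'' := funext fun s => (hdY' s).deriv
  have hCD : ContDiff ℝ 2 Y := by
    rw [show (2 : WithTop ℕ∞) = 1 + 1 by norm_num, contDiff_succ_iff_deriv]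
    refine ⟨fun s => (hdY s).differentiableAt, by simp, ?_⟩
    rw [eY, contDiff_one_iff_deriv, eY']
    exact ⟨fun s => (hdY' s).differentiableAt, hYc⟩
  refine ⟨hCD.contDiffOn.congr fun s hs => hLY s hs, ?_, ?_, ?_⟩
  · rw [hLY 0 le_rfl]
    simp [hY, hP, hQ]
  · intro s hs
    have hev : L =ᶠ[nhds s] Y := by
      filter_upwards [Ioi_mem_nhds hs] with x hx using hLY x (le_of_lt hx)
    rw [hev.deriv.deriv_eq, hev.deriv_eq, hev.eq_of_nhds, eY, eY', ← hgf s hs.le]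
    simp only [hY, hY', hY'']
    have hbeta : β = - (d1 * (l1 * l2)) := by linarith
    rw [← hsum, hbeta]
    linear_combination (-g s) * hKd
  · refine ⟨K * (A / (α - l1) + |J| + A / (l2 - α)), fun s hs => ?_⟩
    have hKp : 0 < K := by
      rw [hK]; have : 0 < l2 - l1 := by linarith
      positivity
    rw [hLY s hs]
    simp only [hY]
    rw [abs_mul, abs_of_pos hKp, mul_assoc]
    apply mul_le_mul_of_nonneg_left _ hKp.le
    have b1 : |Real.exp (l1 * s) * P s| ≤ A / (α - l1) * Real.exp (α * s) := by
      rw [abs_mul, abs_of_pos (Real.exp_pos _)]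
      have := mul_le_mul_of_nonneg_left (head_bound A α l1 (by linarith) hA g hgb s hs)
        (Real.exp_pos (l1 * s)).le
      refine this.trans (le_of_eq ?_)
      rw [show α * s = l1 * s + (α - l1) * s by ring, Real.exp_add]
      ring
    have b2 : |Real.exp (l2 * s) * (J - Q s)| ≤ A / (l2 - α) * Real.exp (α * s) := by
      rw [abs_mul, abs_of_pos (Real.exp_pos _), ← htail s hs]
      have := mul_le_mul_of_nonneg_left (tail_bound A α l2 hl2 f hf hfb s hs).2
        (Real.exp_pos (l2 * s)).le
      refine this.trans (le_of_eq ?_)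
      rw [show α * s = l2 * s + (α - l2) * s by ring, Real.exp_add]
      ring
    have b3 : |Real.exp (l1 * s) * J| ≤ |J| * Real.exp (α * s) := by
      rw [abs_mul, abs_of_pos (Real.exp_pos _), mul_comm]
      apply mul_le_mul_of_nonneg_left _ (abs_nonneg _)
      apply Real.exp_le_exp.2
      nlinarith
    have t1 := abs_add_le (Real.exp (l1 * s) * (P s - J)) (Real.exp (l2 * s) * (J - Q s))
    have t2 := abs_sub (Real.exp (l1 * s) * P s) (Real.exp (l1 * s) * J)
    rw [← mul_sub] at t2
    linarith

theorem stmt15 (d1 c β A α : ℝ) (hd1 : 0 < d1) (hc : 0 < c) (hβ : 0 < β)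
    (hA : 0 < A) (hα : 0 < α) (hα' : α < min (-(lam1 c β d1)) (lam2 c β d1))
    (f : ℝ → ℝ) (hf : ContinuousOn f (Set.Ici 0))
    (hfb : ∀ s ≥ (0:ℝ), |f s| ≤ A * Real.exp (α * s)) :
    IsLinSolution d1 c β α f (linSol d1 c β f) ∧
    (∀ y : ℝ → ℝ, IsLinSolution d1 c β α f y →
      Set.EqOn y (linSol d1 c β f) (Set.Ici 0)) := by
  have h1 := lt_of_lt_of_le hα' (min_le_left _ _)
  have h2 := lt_of_lt_of_le hα' (min_le_right _ _)
  have hl1 : lam1 c β d1 < 0 := by linarith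
  have hex := sol_exists d1 c β A α hd1 hβ hA hα hl1 h2 f hf hfb
  obtain ⟨hl, hsum, hprod⟩ := lam_facts c β d1 hd1 hβ
  exact ⟨hex, fun y hy => sol_unique d1 c β α _ _ hd1 hl hl1 hα h2 hsum hprod f y _ hy hex⟩
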